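/- Let m₁, m₂, Ω₁, Ω₂ > 0 and let α and β be independent random variables with Nakagami-m densities of parameters (m₁, Ω₁) and (m₂, Ω₂) respectively, and set Θ_j = √(m_j/Ω_j) for j = 1,2. Then the product V = αβ has probability density f_V(v) = (4 (Θ₁Θ₂)^{m₁+m₂} / (Γ(m₁) Γ(m₂))) · v^{m₁+m₂−1} · K_{m₁−m₂}(2 Θ₁Θ₂ v) for v > 0, where K_ν(z) = (1/2) ∫₀^∞ t^{ν−1} exp(−(z/2)(t + 1/t)) dt is the modified Bessel function of the second kind. -/

import Mathlib

open MeasureTheory Real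

/-- The modified Bessel function of the second kind of order `ν`, via the integral
representation `K_ν(z) = (1/2) ∫₀^∞ t^(ν−1) exp(−(z/2)(t + 1/t)) dt`. -/
noncomputable def besselK (ν z : ℝ) : ℝ :=
  (1 / 2) * ∫ t in Set.Ioi (0 : ℝ), t ^ (ν - 1) * Real.exp (-(z / 2) * (t + 1 / t))

/-- Scaling formula for the Lebesgue integral of a nonnegative function on the line. -/
theorem lintegral_eq_mul_lintegral_comp_inv_mul {F : ℝ → ENNReal} (hF : Measurable F) {x : ℝ}
    (hx : x ≠ 0) : ∫⁻ y, F y = ∫⁻ v, F (x⁻¹ * v) * ENNReal.ofReal |x⁻¹| := by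
  rw [lintegral_mul_const _ (by fun_prop), mul_comm]
  conv_lhs => rw [← Real.smul_map_volume_mul_left (inv_ne_zero hx)]
  rw [lintegral_smul_measure, lintegral_map hF (by fun_prop), smul_eq_mul]

/-- The density of the product of two independent real random variables with densities. -/
theorem map_mul_eq_withDensity_of_indepFun {α : Type*} [MeasurableSpace α] {μ : Measure α}
    [IsFiniteMeasure μ] {a b : α → ℝ} (ha : Measurable a) (hb : Measurable b)
    (hind : ProbabilityTheory.IndepFun a b μ) {f g : ℝ → ENNReal} (hf : Measurable f)
    (hg : Measurable g) (hlawa : μ.map a = volume.withDensity f)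
    (hlawb : μ.map b = volume.withDensity g) :
    μ.map (fun ω => a ω * b ω) = volume.withDensity
      (fun v => ∫⁻ x, f x * (g (x⁻¹ * v) * ENNReal.ofReal |x⁻¹|)) := by
  have hprod := (ProbabilityTheory.indepFun_iff_map_prod_eq_prod_map_map
    ha.aemeasurable hb.aemeasurable).1 hind
  have hmul : Measurable fun p : ℝ × ℝ => p.1 * p.2 := by fun_prop
  have hmap : μ.map (fun ω => a ω * b ω) =
      ((μ.map a).prod (μ.map b)).map (fun p : ℝ × ℝ => p.1 * p.2) := by
    rw [← hprod, Measure.map_map hmul (ha.prodMk hb)]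
    rfl
  ext s hs
  have hinner : ∀ x : ℝ, x ≠ 0 → (μ.map b) ((fun y => x * y) ⁻¹' s) =
      ∫⁻ v in s, g (x⁻¹ * v) * ENNReal.ofReal |x⁻¹| := by
    intro x hx
    have hs' : MeasurableSet ((fun y => x * y) ⁻¹' s) := measurable_const_mul x hs
    rw [hlawb, withDensity_apply _ hs', ← lintegral_indicator hs', ← lintegral_indicator hs,
      lintegral_eq_mul_lintegral_comp_inv_mul (hg.indicator hs') hx]
    refine lintegral_congr fun v => ?_
    by_cases hv : v ∈ s <;> simp [Set.indicator, hx, hv]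
  rw [hmap, Measure.map_apply hmul hs, Measure.prod_apply (hmul hs), withDensity_apply _ hs,
    lintegral_lintegral_swap (by fun_prop), hlawa,
    lintegral_withDensity_eq_lintegral_mul _ hf (measurable_measure_prodMk_left (hmul hs))]
  refine lintegral_congr_ae ?_
  filter_upwards [compl_mem_ae_iff.2 (measure_singleton (0 : ℝ))] with x hx
  rw [lintegral_const_mul _ (by fun_prop), ← hinner x hx]
  rfl

/-- The integrand defining `besselK ν z` is integrable for `0 < z`. -/
theorem integrableOn_besselK {ν z : ℝ} (hz : 0 < z) :
    IntegrableOn (fun t : ℝ => t ^ (ν - 1) * Real.exp (-(z / 2) * (t + 1 / t)))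
      (Set.Ioi 0) := by
  obtain ⟨n, hn⟩ := exists_nat_gt (-ν)
  have hdom := (integrableOn_rpow_mul_exp_neg_mul_rpow (p := 1) (s := ν + n - 1) (b := z / 2)
    (by linarith) one_pos (by positivity)).const_mul ((n.factorial : ℝ) * (2 / z) ^ n)
  refine hdom.mono' (by fun_prop) ?_
  refine (ae_restrict_iff' measurableSet_Ioi).2 (Filter.Eventually.of_forall fun t ht => ?_)
  have ht : 0 < t := ht
  rw [Real.norm_of_nonneg (by positivity), show ν + n - 1 = (ν - 1) + n by ring,
    Real.rpow_add ht, Real.rpow_natCast, Real.rpow_one,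
    show -(z / 2) * (t + 1 / t) = -(z / (2 * t)) + -(z / 2) * t by field_simp; ring, Real.exp_add]
  have hexp : Real.exp (-(z / (2 * t))) ≤ n.factorial * (2 / z) ^ n * t ^ n := by
    have h := Real.pow_div_factorial_le_exp (z / (2 * t)) (by positivity) n
    rw [Real.exp_neg]
    refine (inv_anti₀ (by positivity) h).trans_eq ?_
    rw [inv_div, mul_assoc, ← mul_pow, div_eq_mul_inv, ← inv_pow]
    congr 2
    field_simp
  calc _ = t ^ (ν - 1) * Real.exp (-(z / 2) * t) * Real.exp (-(z / (2 * t))) := by ring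
    _ ≤ t ^ (ν - 1) * Real.exp (-(z / 2) * t) * (n.factorial * (2 / z) ^ n * t ^ n) := by gcongr
    _ = _ := by ring

/-- The substitution `t = c * x ^ 2` in the integral defining `besselK`. -/
theorem lintegral_mul_comp_const_mul_sq_eq_besselK {ν z c : ℝ} (hz : 0 < z) (hc : 0 < c) :
    ∫⁻ x in Set.Ioi (0 : ℝ), ENNReal.ofReal (x * ((c * x ^ 2) ^ (ν - 1) *
      Real.exp (-(z / 2) * (c * x ^ 2 + 1 / (c * x ^ 2))))) =
    ENNReal.ofReal (c⁻¹ * besselK ν z) := by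
  set h : ℝ → ℝ := fun t => t ^ (ν - 1) * Real.exp (-(z / 2) * (t + 1 / t)) with hh
  have hint : IntegrableOn (fun t => h (c * t)) (Set.Ioi 0) :=
    (integrableOn_Ioi_comp_mul_left_iff h 0 hc).2 (by
      rw [mul_zero]
      exact integrableOn_besselK hz)
  have hsq := (integrableOn_Ioi_comp_rpow_iff (fun t => h (c * t)) (two_ne_zero' ℝ)).2 hint
  have heq := integral_comp_rpow_Ioi (fun t => h (c * t)) (two_ne_zero' ℝ)
  rw [integral_comp_mul_left_Ioi h 0 hc, mul_zero] at heq
  have hpt : ∀ x : ℝ, x * h (c * x ^ 2) =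
      2⁻¹ * ((|(2 : ℝ)| * x ^ ((2 : ℝ) - 1)) • h (c * x ^ (2 : ℝ))) := by
    intro x
    norm_num
    ring
  have hval : ∫ x in Set.Ioi (0 : ℝ), x * h (c * x ^ 2) = c⁻¹ * besselK ν z := by
    simp_rw [hpt]
    rw [integral_const_mul, heq, besselK, smul_eq_mul]
    ring
  rw [← hval, ofReal_integral_eq_lintegral_ofReal]
  · simp_rw [hpt]
    exact hsq.const_mul _
  · refine (ae_restrict_iff' measurableSet_Ioi).2 (Filter.Eventually.of_forall fun x hx => ?_)
    have hx : 0 < x := hx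
    simp only [hh, Pi.zero_apply]
    positivity

/-- The density of a Nakagami random variable, in terms of `θ = √(m / Ω)`. -/
theorem nakagami_density_eq {m Ω : ℝ} (hm : 0 < m) (hΩ : 0 < Ω) (x : ℝ) :
    2 * m ^ m / (Real.Gamma m * Ω ^ m) * x ^ (2 * m - 1) * Real.exp (-m * x ^ 2 / Ω) =
      2 * √(m / Ω) ^ (2 * m) / Real.Gamma m * x ^ (2 * m - 1) *
        Real.exp (-(√(m / Ω) ^ 2 * x ^ 2)) := by
  have hθ : √(m / Ω) ^ (2 * m) = m ^ m / Ω ^ m := by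
    rw [Real.rpow_mul (by positivity), Real.rpow_two, Real.sq_sqrt (by positivity),
      Real.div_rpow hm.le hΩ.le]
  rw [hθ, Real.sq_sqrt (by positivity)]
  congr 1
  · field_simp
  · congr 1
    ring

/-- The integrand of the product density, after normalising to the integrand of `besselK`. -/
theorem nakagami_integrand_eq {m₁ m₂ p q x v : ℝ} (hp : 0 < p) (hq : 0 < q) (hx : 0 < x)
    (hv : 0 < v) :
    2 * p ^ (2 * m₁) / Real.Gamma m₁ * x ^ (2 * m₁ - 1) * Real.exp (-(p ^ 2 * x ^ 2)) *
      (2 * q ^ (2 * m₂) / Real.Gamma m₂ * (x⁻¹ * v) ^ (2 * m₂ - 1) *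
        Real.exp (-(q ^ 2 * (x⁻¹ * v) ^ 2)) * x⁻¹) =
    4 * (p * q) ^ (m₁ + m₂) / (Real.Gamma m₁ * Real.Gamma m₂) * v ^ (m₁ + m₂ - 1) *
      (p / (q * v)) * (x * ((p / (q * v) * x ^ 2) ^ (m₁ - m₂ - 1) *
        Real.exp (-(2 * (p * q) * v / 2) *
          (p / (q * v) * x ^ 2 + 1 / (p / (q * v) * x ^ 2))))) := by
  have hexp : -(2 * (p * q) * v / 2) * (p / (q * v) * x ^ 2 + 1 / (p / (q * v) * x ^ 2)) =
      -(p ^ 2 * x ^ 2) + -(q ^ 2 * (x⁻¹ * v) ^ 2) := by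
    field_simp
    ring
  have hpow : p ^ (2 * m₁) * x ^ (2 * m₁ - 1) * (q ^ (2 * m₂) * (x⁻¹ * v) ^ (2 * m₂ - 1)) * x⁻¹ =
      (p * q) ^ (m₁ + m₂) * v ^ (m₁ + m₂ - 1) * (p / (q * v)) *
        (x * (p / (q * v) * x ^ 2) ^ (m₁ - m₂ - 1)) := by
    refine Real.log_injOn_pos (Set.mem_Ioi.2 (by positivity)) (Set.mem_Ioi.2 (by positivity)) ?_
    simp (disch := positivity) only [Real.log_mul, Real.log_div, Real.log_rpow, Real.log_inv,
      Real.log_pow]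
    push_cast
    ring
  rw [hexp, Real.exp_add]
  linear_combination 4 / (Real.Gamma m₁ * Real.Gamma m₂) * Real.exp (-(p ^ 2 * x ^ 2)) *
    Real.exp (-(q ^ 2 * (x⁻¹ * v) ^ 2)) * hpow

/-- The product of two independent Nakagami-m random variables with
parameters `(m₁, Ω₁)` and `(m₂, Ω₂)` has density
`4 (Θ₁Θ₂)^(m₁+m₂)/(Γ(m₁)Γ(m₂)) · v^(m₁+m₂−1) · K_{m₁−m₂}(2Θ₁Θ₂ v)` for `v > 0`,
where `Θⱼ = √(mⱼ/Ωⱼ)`. -/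
theorem double_nakagami_pdf {α : Type*} [MeasurableSpace α] (μ : Measure α)
    [IsProbabilityMeasure μ]
    (m₁ m₂ Ω₁ Ω₂ : ℝ) (hm₁ : 0 < m₁) (hm₂ : 0 < m₂) (hΩ₁ : 0 < Ω₁) (hΩ₂ : 0 < Ω₂)
    (a b : α → ℝ) (ha : Measurable a) (hb : Measurable b)
    (hind : ProbabilityTheory.IndepFun a b μ)
    (hlawa : μ.map a = volume.withDensity (fun x => ENNReal.ofReal
      (if 0 < x then
        2 * m₁ ^ m₁ / (Real.Gamma m₁ * Ω₁ ^ m₁) * x ^ (2 * m₁ - 1) * Real.exp (-m₁ * x ^ 2 / Ω₁)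
       else 0)))
    (hlawb : μ.map b = volume.withDensity (fun x => ENNReal.ofReal
      (if 0 < x then
        2 * m₂ ^ m₂ / (Real.Gamma m₂ * Ω₂ ^ m₂) * x ^ (2 * m₂ - 1) * Real.exp (-m₂ * x ^ 2 / Ω₂)
       else 0))) :
    μ.map (fun ω => a ω * b ω) = volume.withDensity (fun v => ENNReal.ofReal
      (if 0 < v then
        4 * (Real.sqrt (m₁ / Ω₁) * Real.sqrt (m₂ / Ω₂)) ^ (m₁ + m₂) /
            (Real.Gamma m₁ * Real.Gamma m₂) * v ^ (m₁ + m₂ - 1) *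
          besselK (m₁ - m₂) (2 * (Real.sqrt (m₁ / Ω₁) * Real.sqrt (m₂ / Ω₂)) * v)
       else 0)) := by
  have hmeas : ∀ m Ω : ℝ, Measurable fun x : ℝ => ENNReal.ofReal
      (if 0 < x then
        2 * m ^ m / (Real.Gamma m * Ω ^ m) * x ^ (2 * m - 1) * Real.exp (-m * x ^ 2 / Ω)
       else 0) := fun m Ω =>
    (Measurable.ite measurableSet_Ioi (by fun_prop) measurable_const).ennreal_ofReal
  rw [map_mul_eq_withDensity_of_indepFun ha hb hind (hmeas m₁ Ω₁) (hmeas m₂ Ω₂) hlawa hlawb]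
  have hp : 0 < √(m₁ / Ω₁) := by positivity
  have hq : 0 < √(m₂ / Ω₂) := by positivity
  simp_rw [nakagami_density_eq hm₁ hΩ₁, nakagami_density_eq hm₂ hΩ₂]
  set p := √(m₁ / Ω₁)
  set q := √(m₂ / Ω₂)
  have hΓ₁ := Real.Gamma_pos_of_pos hm₁
  have hΓ₂ := Real.Gamma_pos_of_pos hm₂
  refine congrArg _ (funext fun v => ?_)
  rcases le_or_gt v 0 with hv | hv
  · rw [if_neg hv.not_gt, ENNReal.ofReal_zero]
    refine (lintegral_congr fun x => ?_).trans lintegral_zero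
    by_cases hx : 0 < x
    · rw [if_neg (mul_nonpos_of_nonneg_of_nonpos (inv_pos.2 hx).le hv).not_gt]
      simp
    · simp [hx]
  · set A := 4 * (p * q) ^ (m₁ + m₂) / (Real.Gamma m₁ * Real.Gamma m₂) * v ^ (m₁ + m₂ - 1)
    have hApos : 0 < A := by positivity
    set c := p / (q * v)
    have hcpos : 0 < c := by positivity
    have hz : 0 < 2 * (p * q) * v := by positivity
    rw [if_pos hv]
    calc _ = ∫⁻ x in Set.Ioi (0 : ℝ), ENNReal.ofReal (A * c) *
          ENNReal.ofReal (x * ((c * x ^ 2) ^ (m₁ - m₂ - 1) *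
            Real.exp (-(2 * (p * q) * v / 2) * (c * x ^ 2 + 1 / (c * x ^ 2))))) := by
          rw [← lintegral_indicator measurableSet_Ioi]
          refine lintegral_congr fun x => ?_
          by_cases hx : 0 < x
          · have hxv : 0 < x⁻¹ * v := by positivity
            rw [Set.indicator_of_mem (Set.mem_Ioi.2 hx), if_pos hx, if_pos hxv,
              abs_of_pos (inv_pos.2 hx), ← ENNReal.ofReal_mul (by positivity),
              ← ENNReal.ofReal_mul (by positivity), ← ENNReal.ofReal_mul (by positivity),
              nakagami_integrand_eq hp hq hx hv]
          · simp [hx]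
      _ = _ := by
          rw [lintegral_const_mul _ (by fun_prop),
            lintegral_mul_comp_const_mul_sq_eq_besselK hz hcpos,
            ← ENNReal.ofReal_mul (by positivity)]
          congr 1
          field_simp
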